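/- arXiv:1503.00192 — 2 statements merged into one kernel-verified Lean document; each statement's English description precedes it below -/
import Mathlib

section
/- For every function u in W^{1,1}(R^d) and every r > 0, there exist constants c, C > 0 depending only on d such that ∫_{R^d} (|∇u| + C r^{-1} |u|) dx ≥ c (sup_{a ∈ R^d} |B_r(a) ∩ {u ≠ 0}|)^{-1/d} ∫_{R^d} |u| dx. -/
open MeasureTheory Filter Metric Set Topology

noncomputable section

/-- De Giorgi perimeter: the set of values `∫_E div F` over admissible vector fields. -/
def perSet (d : ℕ) (E : Set (EuclideanSpace ℝ (Fin d))) : Set ℝ :=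
  {p | ∃ F : EuclideanSpace ℝ (Fin d) → EuclideanSpace ℝ (Fin d),
      ContDiff ℝ 1 F ∧ HasCompactSupport F ∧ (∀ x, ‖F x‖ ≤ 1) ∧
      p = ∫ x in E, ∑ i, fderiv ℝ F x (EuclideanSpace.single i (1:ℝ)) i}

/-- De Giorgi perimeter of a measurable set. -/
def perimeter (d : ℕ) (E : Set (EuclideanSpace ℝ (Fin d))) : ℝ := sSup (perSet d E)

/-- A set has finite perimeter if the defining supremum is finite. -/
def FinitePerimeter (d : ℕ) (E : Set (EuclideanSpace ℝ (Fin d))) : Prop := BddAbove (perSet d E)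

/-- Riesz interaction energy. -/
def riesz (d : ℕ) (l : ℝ) (A : Set (EuclideanSpace ℝ (Fin d))) : ℝ :=
  (1/2) * ∫ x in A, ∫ y in A, ‖x - y‖ ^ (-l)

abbrev E3 := EuclideanSpace ℝ (Fin 3)

/-- Coulomb self-energy in dimension 3. -/
def coulomb (Ω : Set E3) : ℝ := (1/2) * ∫ x in Ω, ∫ y in Ω, ‖x - y‖⁻¹

/-- Liquid drop energy. -/
def ldEnergy (Ω : Set E3) : ℝ := perimeter 3 Ω + coulomb Ω

/-- Minimal liquid drop energy at mass `A`. -/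
def ldE (A : ℝ) : ℝ :=
  sInf {e | ∃ Ω : Set E3, MeasurableSet Ω ∧ FinitePerimeter 3 Ω ∧
      volume Ω = ENNReal.ofReal A ∧ e = ldEnergy Ω}


open scoped ENNReal

/-- A compactly supported differentiable function on the line is bounded by the total variation
given by its derivative, with no integrability assumption on the derivative. -/
theorem HasCompactSupport.enorm_le_lintegral_deriv {f : ℝ → ℝ} (hf : Differentiable ℝ f)
    (hfc : HasCompactSupport f) (x : ℝ) : ‖f x‖ₑ ≤ ∫⁻ t, ‖deriv f t‖ₑ := by
  by_cases htop : ∫⁻ t, ‖deriv f t‖ₑ = ∞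
  · simp [htop]
  have hint : Integrable (deriv f) :=
    ⟨(measurable_deriv f).aestronglyMeasurable, lt_top_iff_ne_top.2 htop⟩
  have hbot : Tendsto f atBot (𝓝 0) := by
    rw [hasCompactSupport_iff_eventuallyEq, Filter.coclosedCompact_eq_cocompact] at hfc
    exact (hfc.filter_mono _root_.atBot_le_cocompact).tendsto
  have hftc := integral_Iic_of_hasDerivAt_of_tendsto' (a := x)
    (fun t _ => (hf t).hasDerivAt) hint.integrableOn hbot
  rw [sub_zero] at hftc
  rw [← hftc]
  exact (enorm_integral_le_lintegral_enorm _).trans (setLIntegral_le_lintegral _ _)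

/-- Grid-lines form of the `L¹` Sobolev inequality: a function controlled by the integrals of `f`
along all coordinate lines has its `L¹` norm controlled by that of `f`, times the measure of its
support to the power `1 / n`. -/
theorem lintegral_le_measure_support_rpow_mul_lintegral {ι : Type*} [Fintype ι] [Nonempty ι]
    [DecidableEq ι] {g f : (ι → ℝ) → ℝ≥0∞} (hg : Measurable g) (hf : Measurable f)
    (hgf : ∀ x i, g x ≤ ∫⁻ t, f (Function.update x i t)) :
    ∫⁻ x, g x ≤ volume (Function.support g) ^ ((Fintype.card ι : ℝ)⁻¹) * ∫⁻ x, f x := by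
  have hS : MeasurableSet (Function.support g) := measurableSet_support hg
  rcases (Nat.succ_le_of_lt (Fintype.card_pos (α := ι))).eq_or_lt' with hcard | hcard
  · have : Unique ι := Fintype.card_eq_one_iff_nonempty_unique.1 hcard |>.some
    have hmp := volume_preserving_funUnique ι ℝ
    rw [Subsingleton.elim (Unique.fintype : Fintype ι) ‹Fintype ι›] at hmp
    have hline : ∀ x : ι → ℝ, ∫⁻ t, f (Function.update x default t) = ∫⁻ y, f y := by
      intro x
      refine Eq.trans ?_ (hmp.symm.lintegral_comp_emb
        (MeasurableEquiv.measurableEmbedding _) f)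
      refine lintegral_congr fun t => congrArg f ?_
      ext i
      simp [Unique.eq_default i, MeasurableEquiv.funUnique]
    rw [hcard, Nat.cast_one, inv_one, ENNReal.rpow_one,
      ← setLIntegral_eq_of_support_subset (s := Function.support g) subset_rfl, mul_comm,
      ← setLIntegral_const]
    exact lintegral_mono fun x => (hgf x default).trans_eq (hline x)
  have hn : (1 : ℝ) < Fintype.card ι := by exact_mod_cast hcard
  have hp := Real.HolderConjugate.conjExponent hn
  set p := Real.conjExponent (Fintype.card ι) with hp_def
  have hpow : ∫⁻ x, g x ^ p ≤ (∫⁻ x, f x) ^ p := by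
    calc ∫⁻ x, g x ^ p
        = ∫⁻ x, ∏ _i : ι, g x ^ ((1 : ℝ) / (Fintype.card ι - 1 : ℝ)) := by
          congr! 2 with x
          rw [Finset.prod_const, Finset.card_univ, ← ENNReal.rpow_natCast, ← ENNReal.rpow_mul,
            hp_def, Real.conjExponent]
          congr 1
          ring
      _ ≤ ∫⁻ x, ∏ i, (∫⁻ t, f (Function.update x i t)) ^
            ((1 : ℝ) / (Fintype.card ι - 1 : ℝ)) := by
          gcongr with x i
          exact hgf x i
      _ ≤ (∫⁻ x, f x) ^ p := lintegral_prod_lintegral_pow_le _ hp hf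
  have hholder := ENNReal.lintegral_mul_le_Lp_mul_Lq volume hp
    (f := (Function.support g).indicator 1) (g := g)
    ((measurable_one.indicator hS).aemeasurable) hg.aemeasurable
  have hind : (Function.support g).indicator 1 * g = g := by
    ext x
    by_cases hx : g x = 0 <;> simp [hx]
  have hvol : ∫⁻ x, (Function.support g).indicator (1 : (ι → ℝ) → ℝ≥0∞) x ^
      (Fintype.card ι : ℝ) = volume (Function.support g) := by
    rw [← lintegral_indicator_one hS]
    refine lintegral_congr fun x => ?_
    by_cases hx : g x = 0 <;> simp [hx]
  rw [hind, hvol, one_div] at hholder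
  refine hholder.trans ?_
  gcongr
  calc (∫⁻ x, g x ^ p) ^ (1 / p) ≤ ((∫⁻ x, f x) ^ p) ^ (1 / p) := by
        gcongr
        exact one_div_nonneg.2 hp.symm.nonneg
    _ = ∫⁻ x, f x := by
        rw [← ENNReal.rpow_mul, mul_one_div_cancel hp.symm.ne_zero, ENNReal.rpow_one]

/-- The `L¹` Sobolev inequality for compactly supported differentiable functions, with the
measure of the support in place of the critical Lebesgue exponent. -/
theorem HasCompactSupport.lintegral_enorm_le_measure_support_rpow_mul {ι : Type*} [Fintype ι]
    [Nonempty ι] {v : EuclideanSpace ℝ ι → ℝ} (hv : Differentiable ℝ v)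
    (hvc : HasCompactSupport v) :
    ∫⁻ x, ‖v x‖ₑ ≤
      volume (Function.support v) ^ ((Fintype.card ι : ℝ)⁻¹) * ∫⁻ x, ‖fderiv ℝ v x‖ₑ := by
  classical
  have hT := PiLp.volume_preserving_toLp ι
  have hTm : MeasurableEmbedding (WithLp.toLp 2 : (ι → ℝ) → EuclideanSpace ℝ ι) :=
    (MeasurableEquiv.toLp 2 (ι → ℝ)).measurableEmbedding
  have hwc : HasCompactSupport (v ∘ WithLp.toLp 2) :=
    hvc.comp_homeomorph (PiLp.homeomorph 2 (fun _ : ι => ℝ)).symm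
  have hgrid := lintegral_le_measure_support_rpow_mul_lintegral
    (g := fun x : ι → ℝ => ‖v (WithLp.toLp 2 x)‖ₑ)
    (f := fun x : ι → ℝ => ‖fderiv ℝ v (WithLp.toLp 2 x)‖ₑ)
    (hv.continuous.measurable.comp hTm.measurable).enorm
    ((measurable_fderiv ℝ v).comp hTm.measurable).enorm ?_
  · have hsupp : volume (Function.support fun x : ι → ℝ => ‖v (WithLp.toLp 2 x)‖ₑ) =
        volume (Function.support v) := by
      rw [← hT.measure_preimage_emb hTm]
      congr 1
      ext x
      simp
    rwa [hsupp, hT.lintegral_comp_emb hTm (fun x => ‖v x‖ₑ),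
      hT.lintegral_comp_emb hTm (fun x => ‖fderiv ℝ v x‖ₑ)] at hgrid
  · intro x i
    have hline : ∀ t, HasDerivAt (fun t => v (WithLp.toLp 2 (Function.update x i t)))
        (fderiv ℝ v (WithLp.toLp 2 (Function.update x i t)) (EuclideanSpace.single i 1)) t := by
      intro t
      refine (hv _).hasFDerivAt.comp_hasDerivAt t ?_
      exact ((PiLp.continuousLinearEquiv 2 ℝ (fun _ : ι => ℝ)).symm.hasFDerivAt).comp_hasDerivAt t
        (hasDerivAt_update x i t)
    have hbound := HasCompactSupport.enorm_le_lintegral_deriv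
      (fun t => (hline t).differentiableAt)
      (hwc.comp_isClosedEmbedding (isClosedEmbedding_update x i)) (x i)
    simp only [Function.update_eq_self] at hbound
    refine hbound.trans (lintegral_mono fun t => ?_)
    change ‖deriv (fun t => v (WithLp.toLp 2 (Function.update x i t))) t‖ₑ ≤ _
    rw [(hline t).deriv]
    refine (ContinuousLinearMap.le_opENorm _ _).trans_eq ?_
    simp [enorm_eq_nnnorm]

/-- Cutoff functions adapted to balls of radius `r`, with gradient bounded by `L / r`. -/
theorem exists_differentiable_cutoff (E : Type*) [NormedAddCommGroup E] [NormedSpace ℝ E]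
    [FiniteDimensional ℝ E] :
    ∃ L : ℝ, 0 < L ∧ ∀ r : ℝ, 0 < r → ∀ a : E, ∃ φ : E → ℝ, Differentiable ℝ φ ∧
      (∀ x, ‖φ x‖ ≤ 1) ∧ (∀ x ∈ ball a (r / 2), φ x = 1) ∧
      (∀ x ∉ ball a r, φ x = 0 ∧ fderiv ℝ φ x = 0) ∧ ∀ x, ‖fderiv ℝ φ x‖ ≤ L * r⁻¹ := by
  let ψ : ContDiffBump (0 : E) := ⟨1 / 2, 1, by norm_num, by norm_num⟩
  have hψ : ContDiff ℝ 1 ψ := ψ.contDiff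
  obtain ⟨L, hL⟩ := (ψ.hasCompactSupport.fderiv (𝕜 := ℝ)).exists_bound_of_continuous
    (hψ.continuous_fderiv one_ne_zero)
  refine ⟨max L 1, by positivity, fun r hr a => ?_⟩
  have hd : ∀ x, HasFDerivAt (fun x => ψ (r⁻¹ • (x - a)))
      ((fderiv ℝ ψ (r⁻¹ • (x - a))).comp (r⁻¹ • ContinuousLinearMap.id ℝ E)) x := fun x =>
    ((hψ.differentiable one_ne_zero) _).hasFDerivAt.comp x
      (((hasFDerivAt_id x).sub_const a).const_smul r⁻¹)
  have hzero : ∀ x ∉ ball a r, ψ (r⁻¹ • (x - a)) = 0 := by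
    intro x hx
    refine ψ.zero_of_le_dist ?_
    rw [mem_ball, not_lt, dist_eq_norm] at hx
    rw [dist_zero_right, norm_smul, norm_inv, Real.norm_of_nonneg hr.le, inv_mul_eq_div]
    exact (one_le_div hr).2 hx
  refine ⟨fun x => ψ (r⁻¹ • (x - a)), fun x => (hd x).differentiableAt, fun x => ?_,
    fun x hx => ?_, fun x hx => ⟨hzero x hx, ?_⟩, fun x => ?_⟩
  · rw [Real.norm_of_nonneg ψ.nonneg]
    exact ψ.le_one
  · refine ψ.one_of_mem_closedBall ?_
    rw [mem_ball, dist_eq_norm] at hx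
    rw [mem_closedBall, dist_zero_right, norm_smul, norm_inv, Real.norm_of_nonneg hr.le,
      inv_mul_eq_div, div_le_iff₀ hr]
    change _ ≤ 1 / 2 * r
    linarith
  · refine IsLocalMin.fderiv_eq_zero (Eventually.of_forall fun y => ?_)
    simp only [hzero x hx]
    exact ψ.nonneg
  · rw [(hd x).fderiv]
    calc _ ≤ ‖fderiv ℝ ψ (r⁻¹ • (x - a))‖ * ‖r⁻¹ • ContinuousLinearMap.id ℝ E‖ :=
          ContinuousLinearMap.opNorm_comp_le _ _
      _ ≤ max L 1 * r⁻¹ := by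
          gcongr
          · exact (hL _).trans (le_max_left _ _)
          · rw [norm_smul, norm_inv, Real.norm_of_nonneg hr.le]
            exact mul_le_of_le_one_right (by positivity) ContinuousLinearMap.norm_id_le

/-- Averaging integrals over balls of fixed radius over all centers. -/
theorem lintegral_setLIntegral_ball {E : Type*} [NormedAddCommGroup E] [NormedSpace ℝ E]
    [FiniteDimensional ℝ E] [MeasurableSpace E] [BorelSpace E] (μ : Measure E)
    [μ.IsAddHaarMeasure] {h : E → ℝ≥0∞} (hh : Measurable h) (ρ : ℝ) :
    ∫⁻ a, ∫⁻ x in ball a ρ, h x ∂μ ∂μ = μ (ball 0 ρ) * ∫⁻ x, h x ∂μ := by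
  have hmeas : MeasurableSet {p : E × E | dist p.2 p.1 < ρ} :=
    measurableSet_lt (measurable_snd.dist measurable_fst) measurable_const
  calc ∫⁻ a, ∫⁻ x in ball a ρ, h x ∂μ ∂μ
      = ∫⁻ a, ∫⁻ x, {p : E × E | dist p.2 p.1 < ρ}.indicator (fun p => h p.2) (a, x) ∂μ ∂μ := by
        refine lintegral_congr fun a => ?_
        rw [← lintegral_indicator measurableSet_ball]
        rfl
    _ = ∫⁻ x, ∫⁻ a, {p : E × E | dist p.2 p.1 < ρ}.indicator (fun p => h p.2) (a, x) ∂μ ∂μ :=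
        lintegral_lintegral_swap
          (f := fun a x => {p : E × E | dist p.2 p.1 < ρ}.indicator (fun p => h p.2) (a, x))
          ((hh.comp measurable_snd).indicator hmeas).aemeasurable
    _ = ∫⁻ x, μ (ball 0 ρ) * h x ∂μ := by
        refine lintegral_congr fun x => ?_
        rw [← Measure.addHaar_ball_center μ x ρ, mul_comm, ← setLIntegral_const,
          ← lintegral_indicator measurableSet_ball]
        refine lintegral_congr fun a => ?_
        simp [indicator, dist_comm]
    _ = μ (ball 0 ρ) * ∫⁻ x, h x ∂μ := lintegral_const_mul _ hh

/-- The Sobolev inequality localized to balls of radius `r`, in extended nonnegative form. -/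
theorem lintegral_enorm_le_iSup_measure_ball_inter_rpow_mul {ι : Type*} [Fintype ι] [Nonempty ι] :
    ∃ L : ℝ, 0 < L ∧ ∀ u : EuclideanSpace ℝ ι → ℝ, Differentiable ℝ u → ∀ r : ℝ, 0 < r →
      ∫⁻ x, ‖u x‖ₑ ≤ 2 ^ Fintype.card ι *
        (⨆ a, volume (ball a r ∩ {x | u x ≠ 0})) ^ ((Fintype.card ι : ℝ)⁻¹) *
        ∫⁻ x, (‖fderiv ℝ u x‖ₑ + ENNReal.ofReal (L * r⁻¹) * ‖u x‖ₑ) := by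
  obtain ⟨L, hL, hcut⟩ := exists_differentiable_cutoff (EuclideanSpace ℝ ι)
  refine ⟨L, hL, fun u hu r hr => ?_⟩
  set M := ⨆ a, volume (ball a r ∩ {x | u x ≠ 0})
  set h := fun x => ‖fderiv ℝ u x‖ₑ + ENNReal.ofReal (L * r⁻¹) * ‖u x‖ₑ
  have hum : Measurable fun x => ‖u x‖ₑ := hu.continuous.measurable.enorm
  have hh : Measurable h := (measurable_fderiv ℝ u).enorm.add (hum.const_mul _)
  have hlocal : ∀ a, ∫⁻ x in ball a (r / 2), ‖u x‖ₑ ≤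
      M ^ ((Fintype.card ι : ℝ)⁻¹) * ∫⁻ x in ball a r, h x := by
    intro a
    obtain ⟨φ, hφ, hφ1, hφin, hφout, hφ'⟩ := hcut r hr a
    have hsupp : Function.support (fun x => φ x * u x) ⊆ ball a r ∩ {x | u x ≠ 0} := by
      intro x hx
      refine ⟨?_, right_ne_zero_of_mul hx⟩
      by_contra hxa
      exact left_ne_zero_of_mul hx (hφout x hxa).1
    have hcpt : HasCompactSupport fun x => φ x * u x :=
      HasCompactSupport.of_support_subset_isCompact (isCompact_closedBall a r)
        (hsupp.trans (inter_subset_left.trans ball_subset_closedBall))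
    have hfderiv : ∀ x, fderiv ℝ (fun x => φ x * u x) x = φ x • fderiv ℝ u x + u x • fderiv ℝ φ x :=
      fun x => fderiv_fun_mul (hφ x) (hu x)
    calc ∫⁻ x in ball a (r / 2), ‖u x‖ₑ
        = ∫⁻ x in ball a (r / 2), ‖φ x * u x‖ₑ :=
          setLIntegral_congr_fun measurableSet_ball fun x hx => by simp [hφin x hx]
      _ ≤ ∫⁻ x, ‖φ x * u x‖ₑ := setLIntegral_le_lintegral _ _
      _ ≤ volume (Function.support fun x => φ x * u x) ^ ((Fintype.card ι : ℝ)⁻¹) *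
            ∫⁻ x, ‖fderiv ℝ (fun x => φ x * u x) x‖ₑ :=
          hcpt.lintegral_enorm_le_measure_support_rpow_mul (hφ.mul hu)
      _ = volume (Function.support fun x => φ x * u x) ^ ((Fintype.card ι : ℝ)⁻¹) *
            ∫⁻ x in ball a r, ‖fderiv ℝ (fun x => φ x * u x) x‖ₑ := by
          congr 1
          refine (setLIntegral_eq_of_support_subset fun x hx => ?_).symm
          by_contra hxa
          refine hx ?_
          beta_reduce
          rw [← ofReal_norm, hfderiv, (hφout x hxa).1, (hφout x hxa).2, zero_smul, smul_zero,
            add_zero, norm_zero, ENNReal.ofReal_zero]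
      _ ≤ M ^ ((Fintype.card ι : ℝ)⁻¹) * ∫⁻ x in ball a r, h x := by
          gcongr with x
          · exact (measure_mono hsupp).trans
              (le_iSup (fun a => volume (ball a r ∩ {x | u x ≠ 0})) a)
          · rw [hfderiv]
            have hnorm : ‖φ x • fderiv ℝ u x + u x • fderiv ℝ φ x‖ ≤
                ‖fderiv ℝ u x‖ + L * r⁻¹ * ‖u x‖ := by
              refine (norm_add_le _ _).trans ?_
              rw [norm_smul, norm_smul, mul_comm ‖u x‖]
              gcongr
              · exact mul_le_of_le_one_left (norm_nonneg _) (hφ1 x)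
              · exact hφ' x
            rw [← ofReal_norm]
            refine (ENNReal.ofReal_le_ofReal hnorm).trans_eq ?_
            rw [ENNReal.ofReal_add (by positivity) (by positivity),
              ENNReal.ofReal_mul (by positivity), ofReal_norm, ofReal_norm]
  have hball : volume (ball (0 : EuclideanSpace ℝ ι) r) =
      2 ^ Fintype.card ι * volume (ball (0 : EuclideanSpace ℝ ι) (r / 2)) := by
    have := Measure.addHaar_ball_mul volume (0 : EuclideanSpace ℝ ι) zero_le_two (r / 2)
    rw [mul_div_cancel₀ r two_ne_zero, finrank_euclideanSpace] at this
    rw [this, ENNReal.ofReal_pow zero_le_two, ENNReal.ofReal_ofNat]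
  have hmain := lintegral_mono (μ := volume) hlocal
  have hM : M ≠ ∞ := by
    refine ne_top_of_le_ne_top (measure_ball_lt_top (x := (0 : EuclideanSpace ℝ ι))
      (r := r) (μ := volume)).ne (iSup_le fun a => ?_)
    exact (measure_mono inter_subset_left).trans_eq (Measure.addHaar_ball_center volume a r)
  rw [lintegral_const_mul' _ _ (ENNReal.rpow_ne_top_of_nonneg (by positivity) hM),
    lintegral_setLIntegral_ball _ hum,
    lintegral_setLIntegral_ball _ hh, hball] at hmain
  refine (ENNReal.mul_le_mul_iff_right (measure_ball_pos volume (0 : EuclideanSpace ℝ ι)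
    (half_pos hr)).ne' measure_ball_lt_top.ne).1 (hmain.trans_eq ?_)
  ring

/-- localized Sobolev-type inequality for `W^{1,1}` functions. -/
theorem sobolev_localized (d : ℕ) (hd : 0 < d) :
    ∃ c C : ℝ, 0 < c ∧ 0 < C ∧
      ∀ u : EuclideanSpace ℝ (Fin d) → ℝ, Differentiable ℝ u →
        Integrable u → Integrable (fun x => ‖fderiv ℝ u x‖) →
        ∀ r : ℝ, 0 < r →
          c * ((⨆ a : EuclideanSpace ℝ (Fin d),
                volume (ball a r ∩ {x | u x ≠ 0})).toReal) ^ (-(1:ℝ)/d) *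
              ∫ x, |u x| ≤
            ∫ x, (‖fderiv ℝ u x‖ + C * r⁻¹ * |u x|) := by
  have : Nonempty (Fin d) := ⟨⟨0, hd⟩⟩
  obtain ⟨L, hL, hsob⟩ := lintegral_enorm_le_iSup_measure_ball_inter_rpow_mul (ι := Fin d)
  refine ⟨(2 ^ d)⁻¹, L, by positivity, hL, fun u hu hui hui' r hr => ?_⟩
  have hineq := hsob u hu r hr
  rw [Fintype.card_fin] at hineq
  set M := ⨆ a, volume (ball a r ∩ {x | u x ≠ 0})
  have hM : M ≠ ∞ := by
    refine ne_top_of_le_ne_top (measure_ball_lt_top (x := (0 : EuclideanSpace ℝ (Fin d)))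
      (r := r) (μ := volume)).ne (iSup_le fun a => ?_)
    exact (measure_mono inter_subset_left).trans_eq (Measure.addHaar_ball_center volume a r)
  have hint : Integrable fun x => ‖fderiv ℝ u x‖ + L * r⁻¹ * |u x| :=
    hui'.add (hui.abs.const_mul _)
  have hnonneg : ∀ x, 0 ≤ ‖fderiv ℝ u x‖ + L * r⁻¹ * |u x| := fun x => by positivity
  have hrhs : ∫⁻ x, (‖fderiv ℝ u x‖ₑ + ENNReal.ofReal (L * r⁻¹) * ‖u x‖ₑ) =
      ENNReal.ofReal (∫ x, (‖fderiv ℝ u x‖ + L * r⁻¹ * |u x|)) := by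
    rw [ofReal_integral_eq_lintegral_ofReal hint (Eventually.of_forall hnonneg)]
    refine lintegral_congr fun x => ?_
    rw [ENNReal.ofReal_add (by positivity) (by positivity), ofReal_norm,
      ENNReal.ofReal_mul (p := L * r⁻¹) (by positivity), ← Real.norm_eq_abs, ofReal_norm]
  have hlhs : ∫ x, |u x| = (∫⁻ x, ‖u x‖ₑ).toReal :=
    integral_norm_eq_lintegral_enorm hui.aestronglyMeasurable
  have hR : 0 ≤ ∫ x, (‖fderiv ℝ u x‖ + L * r⁻¹ * |u x|) := integral_nonneg hnonneg
  have hreal : ∫ x, |u x| ≤ 2 ^ d * M.toReal ^ ((d : ℝ)⁻¹) *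
      ∫ x, (‖fderiv ℝ u x‖ + L * r⁻¹ * |u x|) := by
    rw [hrhs] at hineq
    have htop : 2 ^ d * M ^ ((d : ℝ)⁻¹) *
        ENNReal.ofReal (∫ x, (‖fderiv ℝ u x‖ + L * r⁻¹ * |u x|)) ≠ ∞ := by
      finiteness
    rw [hlhs]
    refine (ENNReal.toReal_mono htop hineq).trans_eq ?_
    rw [ENNReal.toReal_mul, ENNReal.toReal_mul, ENNReal.toReal_ofReal hR, ENNReal.toReal_pow,
      ← ENNReal.toReal_rpow, ENNReal.toReal_ofNat]
  rw [neg_div, one_div]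
  rcases (ENNReal.toReal_nonneg (a := M)).eq_or_lt' with hM0 | hM0
  · rw [hM0, Real.zero_rpow (by simpa using hd.ne')]
    simpa using hR
  · rw [Real.rpow_neg hM0.le, ← mul_inv, inv_mul_le_iff₀ (by positivity)]
    exact hreal
end
end

section
/- Let (E_n) be a sequence of measurable sets in R^d of finite perimeter with sup_n Per(E_n) < ∞. Then either |E_n| → 0, or there exist a measurable set E with |E| > 0, a sequence of vectors (a_k) in R^d, and a subsequence (n_k) such that E_{n_k} − a_k → E locally (i.e., |((E_{n_k} − a_k) Δ E) ∩ K| → 0 for every compact K), with |E| ≤ liminf_k |E_{n_k}| and Per(E) ≤ liminf_k Per(E_{n_k}). -/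
open MeasureTheory Filter Metric Set Topology

noncomputable section

section

variable {d : ℕ}

local notation "𝔼" d => EuclideanSpace ℝ (Fin d)

theorem zero_mem_perSet (E : Set (𝔼 d)) : (0 : ℝ) ∈ perSet d E :=
  ⟨0, contDiff_const, HasCompactSupport.zero, by simp, by simp⟩

theorem perimeter_nonneg {E : Set (𝔼 d)} (hE : FinitePerimeter d E) : 0 ≤ perimeter d E :=
  le_csSup hE (zero_mem_perSet E)

/-- Testing the perimeter with the field `x ↦ ψ (y - x) • h`. -/
theorem abs_setIntegral_fderiv_sub_le {E : Set (𝔼 d)} (hE : FinitePerimeter d E)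
    {ψ : (𝔼 d) → ℝ} (hψ : ContDiff ℝ 1 ψ) (hc : HasCompactSupport ψ) (h1 : ∀ x, |ψ x| ≤ 1)
    (y h : 𝔼 d) :
    |∫ x in E, fderiv ℝ ψ (y - x) h| ≤ perimeter d E * ‖h‖ := by
  have key : ∀ e : 𝔼 d, ‖e‖ ≤ 1 → -∫ x in E, fderiv ℝ ψ (y - x) e ≤ perimeter d E := by
    intro e he
    refine le_csSup hE ⟨fun x => ψ (y - x) • e, ?_, ?_, ?_, ?_⟩
    · exact (hψ.comp (contDiff_const.sub contDiff_id)).smul contDiff_const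
    · exact (hc.comp_homeomorph (Homeomorph.subLeft y)).smul_right (f' := fun _ => e)
    · intro x
      rw [norm_smul]
      exact mul_le_one₀ (h1 _) (norm_nonneg _) he
    · rw [← integral_neg]
      congr 1
      ext x
      have hd : HasFDerivAt (fun x => ψ (y - x) • e)
          (((fderiv ℝ ψ (y - x)).comp (-ContinuousLinearMap.id ℝ (𝔼 d))).smulRight e) x := by
        have h2 : HasFDerivAt (fun x : 𝔼 d => y - x) (-ContinuousLinearMap.id ℝ (𝔼 d)) x :=
          (hasFDerivAt_id x).const_sub y
        exact (((hψ.differentiable (by simp)) (y - x)).hasFDerivAt.comp x h2).smul_const e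
      rw [hd.fderiv]
      have hs : e = ∑ i, e i • EuclideanSpace.single i (1 : ℝ) := by
        ext j
        simp [Finset.sum_apply, Pi.single_apply]
      conv_lhs => rw [hs]
      simp [map_sum, mul_comm]
  have hneg : ∀ e : 𝔼 d, ∫ x in E, fderiv ℝ ψ (y - x) (-e) = -∫ x in E, fderiv ℝ ψ (y - x) e := by
    intro e
    simp [integral_neg]
  rcases eq_or_ne h 0 with rfl | hh
  · simp
  have hpos : 0 < ‖h‖ := norm_pos_iff.2 hh
  set e := ‖h‖⁻¹ • h with he
  have hn : ‖e‖ ≤ 1 := by rw [he, norm_smul, norm_inv, norm_norm, inv_mul_cancel₀ hpos.ne']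
  have hhe : h = ‖h‖ • e := by rw [he, smul_smul, mul_inv_cancel₀ hpos.ne', one_smul]
  have hI : ∫ x in E, fderiv ℝ ψ (y - x) h = ‖h‖ * ∫ x in E, fderiv ℝ ψ (y - x) e := by
    rw [← integral_const_mul]
    conv_lhs => rw [hhe]
    simp
  have ha : |∫ x in E, fderiv ℝ ψ (y - x) e| ≤ perimeter d E := by
    rw [abs_le']
    refine ⟨?_, key e hn⟩
    have := key (-e) (by rwa [norm_neg])
    rwa [hneg, neg_neg] at this
  rw [hI, abs_mul, abs_of_pos hpos, mul_comm]
  gcongr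

theorem abs_setIntegral_sub_le {E : Set (𝔼 d)} (hm : MeasurableSet E)
    (hE : FinitePerimeter d E)
    {ψ : (𝔼 d) → ℝ} (hψ : ContDiff ℝ 1 ψ) (hc : HasCompactSupport ψ) (h1 : ∀ x, |ψ x| ≤ 1)
    (h : 𝔼 d) :
    |(∫ x in E, ψ (h - x)) - ∫ x in E, ψ (0 - x)| ≤ perimeter d E * ‖h‖ := by
  have hloc : LocallyIntegrable (E.indicator fun _ => (1 : ℝ)) :=
    (locallyIntegrable_const 1).indicator hm
  let L := ContinuousLinearMap.lsmul ℝ ℝ (E := ℝ)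
  let G : (𝔼 d) → ℝ := MeasureTheory.convolution (E.indicator fun _ => (1 : ℝ)) ψ L volume
  have hG : ∀ y, G y = ∫ x in E, ψ (y - x) := by
    intro y
    simp only [G, convolution_def, L, ContinuousLinearMap.lsmul_apply]
    rw [← integral_indicator hm]
    congr 1
    ext x
    by_cases hx : x ∈ E <;> simp [hx]
  have hdG : ∀ y, HasFDerivAt G (MeasureTheory.convolution (E.indicator fun _ => (1 : ℝ))
      (fderiv ℝ ψ) (L.precompR (𝔼 d)) volume y) y := fun y =>
    hc.hasFDerivAt_convolution_right L hloc hψ y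
  have hbound : ∀ y, ‖MeasureTheory.convolution (E.indicator fun _ => (1 : ℝ))
      (fderiv ℝ ψ) (L.precompR (𝔼 d)) volume y‖ ≤ perimeter d E := by
    intro y
    refine ContinuousLinearMap.opNorm_le_bound _ (perimeter_nonneg hE) fun v => ?_
    rw [convolution_precompR_apply L hloc (hc.fderiv ℝ) (hψ.continuous_fderiv (by simp)),
      Real.norm_eq_abs]
    convert abs_setIntegral_fderiv_sub_le hE hψ hc h1 y v using 2
    simp only [convolution_def, L, ContinuousLinearMap.lsmul_apply]
    rw [← integral_indicator hm]
    congr 1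
    ext x
    by_cases hx : x ∈ E <;> simp [hx]
  have := convex_univ.norm_image_sub_le_of_norm_hasFDerivWithin_le
    (fun y _ => (hdG y).hasFDerivWithinAt) (fun y _ => hbound y) (mem_univ (0 : 𝔼 d)) (mem_univ h)
  simpa [hG] using this

/-- The `L¹` translation estimate for sets of finite perimeter. -/
theorem volume_symmDiff_translate_le {E : Set (𝔼 d)} (hm : MeasurableSet E)
    (hE : FinitePerimeter d E) (h : 𝔼 d) :
    volume (symmDiff ((fun x => x + h) ⁻¹' E) E) ≤ ENNReal.ofReal (perimeter d E * ‖h‖) := by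
  set E₁ : Set (𝔼 d) := (fun x => x + h) ⁻¹' E with hE₁
  have hm₁ : MeasurableSet E₁ := measurable_add_const h hm
  set s : (𝔼 d) → ℝ := fun x => E₁.indicator 1 x - E.indicator 1 x with hs
  have hsm : Measurable s := (measurable_one.indicator hm₁).sub (measurable_one.indicator hm)
  have hs1 : ∀ x, |s x| ≤ 1 := by
    intro x
    by_cases hx : x ∈ E₁ <;> by_cases hy : x ∈ E <;> simp [hs, hx, hy]
  have hss : ∀ x, s x * s x = (symmDiff E₁ E).indicator 1 x := by
    intro x
    by_cases hx : x ∈ E₁ <;> by_cases hy : x ∈ E <;> simp [hs, hx, hy, mem_symmDiff]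
  have hint : ∀ φ : (𝔼 d) → ℝ, ContDiff ℝ 1 φ → HasCompactSupport φ → (∀ x, |φ x| ≤ 1) →
      ∫ x, s x * φ x ≤ perimeter d E * ‖h‖ := by
    intro φ hφ hc h1
    have hi : Integrable φ := hφ.continuous.integrable_of_hasCompactSupport hc
    have e1 : ∫ x, s x * φ x = (∫ x in E₁, φ x) - ∫ x in E, φ x := by
      rw [← integral_indicator hm₁, ← integral_indicator hm,
        ← integral_sub (hi.indicator hm₁) (hi.indicator hm)]
      congr 1
      ext x
      by_cases hx : x ∈ E₁ <;> by_cases hy : x ∈ E <;> simp [hs, hx, hy]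
    have e2 : ∫ x in E₁, φ x = ∫ x in E, φ (x - h) := by
      rw [← integral_indicator hm₁, ← integral_indicator hm,
        ← integral_add_right_eq_self (E.indicator fun x => φ (x - h)) h]
      congr 1
      ext x
      by_cases hx : x + h ∈ E <;> simp [hE₁, hx]
    have := abs_setIntegral_sub_le hm hE (ψ := fun z => φ (-z)) (hφ.comp contDiff_neg)
      (hc.comp_homeomorph (Homeomorph.neg _)) (fun x => h1 _) h
    simp only [neg_sub, sub_zero] at this
    rw [e1, e2]
    exact (le_abs_self _).trans this
  have hball : ∀ R : ℕ, volume (symmDiff E₁ E ∩ ball 0 R) ≤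
      ENNReal.ofReal (perimeter d E * ‖h‖) := by
    intro R
    set g : (𝔼 d) → ℝ := (ball 0 (R : ℝ)).indicator s with hg
    have hg1 : ∀ x, |g x| ≤ 1 := by
      intro x
      by_cases hx : x ∈ ball (0 : 𝔼 d) (R : ℝ)
      · simpa [hg, indicator_of_mem hx] using hs1 x
      · simp [hg, indicator_of_notMem hx]
    have hgm : Measurable g := hsm.indicator measurableSet_ball
    have hgi : Integrable g := by
      refine IntegrableOn.integrable_indicator ?_ measurableSet_ball
      exact Measure.integrableOn_of_bounded (M := 1) measure_ball_lt_top.ne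
        hsm.aestronglyMeasurable (ae_of_all _ hs1)
    have hgl : LocallyIntegrable g := hgi.locallyIntegrable
    have hgc : HasCompactSupport g :=
      HasCompactSupport.intro (isCompact_closedBall (0 : 𝔼 d) (R : ℝ)) fun x hx =>
        indicator_of_notMem (fun hx' => hx (ball_subset_closedBall hx')) _
    let b : ℕ → ContDiffBump (0 : 𝔼 d) := fun n =>
      ⟨1 / ((n : ℝ) + 1) / 2, 1 / ((n : ℝ) + 1), by positivity, by
        exact half_lt_self (by positivity)⟩
    let φ : ℕ → (𝔼 d) → ℝ := fun n => MeasureTheory.convolution ((b n).normed volume) g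
      (ContinuousLinearMap.lsmul ℝ ℝ) volume
    have hlim : ∀ᵐ x, Tendsto (fun n => φ n x) atTop (𝓝 (g x)) :=
      ContDiffBump.ae_convolution_tendsto_right_of_locallyIntegrable (K := 2)
        tendsto_one_div_add_atTop_nhds_zero_nat
        (Eventually.of_forall fun n => by simp only [b]; linarith) hgl
    have hφd : ∀ n, ContDiff ℝ 1 (φ n) := fun n =>
      (b n).hasCompactSupport_normed.contDiff_convolution_left _ (b n).contDiff_normed hgl
    have hφc : ∀ n, HasCompactSupport (φ n) := fun n =>
      HasCompactSupport.convolution _ (b n).hasCompactSupport_normed hgc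
    have hφ1 : ∀ n x, |φ n x| ≤ 1 := by
      intro n x
      have := dist_convolution_le (x₀ := x) (z₀ := 0) (ε := 1) (R := (b n).rOut) zero_le_one
        (b n).support_normed_eq.subset (b n).nonneg_normed (b n).integral_normed
        hgm.aestronglyMeasurable (μ := volume) (fun y _ => by simpa using hg1 y)
      simpa using this
    have hφs : ∀ n x, x ∉ ball (0 : 𝔼 d) (R + 1) → φ n x = 0 := by
      intro n x hx
      by_contra hne
      have h3 := support_convolution_subset (ContinuousLinearMap.lsmul ℝ ℝ) (show x ∈ _ from hne)
      obtain ⟨u, hu, v, hv, rfl⟩ := h3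
      rw [(b n).support_normed_eq, mem_ball_zero_iff] at hu
      have hv' : v ∈ ball (0 : 𝔼 d) (R : ℝ) := by
        by_contra h4
        exact hv (indicator_of_notMem h4 _)
      rw [mem_ball_zero_iff] at hv' hx
      have h5 : (b n).rOut ≤ 1 := by
        simp only [b]
        rw [div_le_one (by positivity)]
        linarith [(Nat.cast_nonneg n : (0 : ℝ) ≤ n)]
      exact hx ((norm_add_le u v).trans_lt (by linarith))
    have hconv : Tendsto (fun n => ∫ x, s x * φ n x) atTop (𝓝 (∫ x, s x * g x)) := by
      refine tendsto_integral_of_dominated_convergence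
        ((ball (0 : 𝔼 d) (R + 1)).indicator fun _ => (1 : ℝ)) ?_ ?_ ?_ ?_
      · exact fun n => (hsm.aestronglyMeasurable.mul (hφd n).continuous.aestronglyMeasurable)
      · exact (integrableOn_const measure_ball_lt_top.ne).integrable_indicator measurableSet_ball
      · refine fun n => ae_of_all _ fun x => ?_
        by_cases hx : x ∈ ball (0 : 𝔼 d) (R + 1)
        · rw [indicator_of_mem hx, norm_mul]
          exact mul_le_one₀ (hs1 x) (norm_nonneg _) (hφ1 n x)
        · simp [indicator_of_notMem hx, hφs n x hx]
      · filter_upwards [hlim] with x hx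
        exact hx.const_mul _
    have hle : ∫ x, s x * g x ≤ perimeter d E * ‖h‖ :=
      le_of_tendsto' hconv fun n => hint _ (hφd n) (hφc n) (hφ1 n)
    have hmS : MeasurableSet (symmDiff E₁ E ∩ ball 0 (R : ℝ)) :=
      (hm₁.symmDiff hm).inter measurableSet_ball
    have heq : ∫ x, s x * g x = volume.real (symmDiff E₁ E ∩ ball 0 (R : ℝ)) := by
      rw [← integral_indicator_one hmS]
      congr 1
      ext x
      by_cases hx : x ∈ ball (0 : 𝔼 d) (R : ℝ)
      · rw [hg, indicator_of_mem hx, hss, inter_indicator_one]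
        simp [indicator_of_mem hx]
      · rw [hg, indicator_of_notMem hx, inter_indicator_one]
        simp [indicator_of_notMem hx]
    rw [← ofReal_measureReal ((measure_mono inter_subset_right).trans_lt measure_ball_lt_top).ne,
      ← heq]
    exact ENNReal.ofReal_le_ofReal hle
  have hU : symmDiff E₁ E = ⋃ R : ℕ, symmDiff E₁ E ∩ ball 0 (R : ℝ) := by
    rw [← inter_iUnion, iUnion_ball_nat, inter_univ]
  rw [hU]
  refine le_of_tendsto' (tendsto_measure_iUnion_atTop ?_) hball
  exact fun i j hij => inter_subset_inter_right _ (ball_subset_ball (by exact_mod_cast hij))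

/-- On average over `x`, the indicator of a set of finite perimeter is close to its density in
the ball of radius `r` about `x`. -/
theorem lintegral_enorm_indicator_sub_le {E : Set (𝔼 d)} (hm : MeasurableSet E)
    (hE : FinitePerimeter d E) (r : ℝ) :
    ∫⁻ x, ‖E.indicator (fun _ => volume.real (ball (0 : 𝔼 d) r)) x
      - volume.real (E ∩ ball x r)‖ₑ ≤
      volume (ball (0 : 𝔼 d) r) * ENNReal.ofReal (perimeter d E * r) := by
  let S : Set ((𝔼 d) × (𝔼 d)) :=
    (Prod.snd ⁻¹' ball 0 r) ∩ symmDiff ((fun p => p.1 + p.2) ⁻¹' E) (Prod.fst ⁻¹' E)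
  have hS : MeasurableSet S := (measurable_snd measurableSet_ball).inter
    (((measurable_fst.add measurable_snd) hm).symmDiff (measurable_fst hm))
  have hpt : ∀ x, ‖E.indicator (fun _ => volume.real (ball (0 : 𝔼 d) r)) x
      - volume.real (E ∩ ball x r)‖ₑ ≤ volume (Prod.mk x ⁻¹' S) := by
    intro x
    let T : Set (𝔼 d) := ball 0 r ∩ (fun y => x + y) ⁻¹' E
    have hTm : MeasurableSet T := measurableSet_ball.inter (measurable_const_add x hm)
    have hT : volume.real (E ∩ ball x r) = volume.real T := by
      have : T = (fun y => x + y) ⁻¹' (E ∩ ball x r) := by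
        rw [preimage_inter, preimage_add_ball, sub_self, inter_comm]
      rw [this, measureReal_def, measureReal_def, measure_preimage_add]
    have hfin : volume (Prod.mk x ⁻¹' S) ≠ ⊤ :=
      ((measure_mono fun y hy => hy.1).trans_lt (measure_ball_lt_top (x := (0 : 𝔼 d)) (r := r))).ne
    rw [hT, ← ofReal_measureReal hfin, Real.enorm_eq_ofReal_abs]
    refine ENNReal.ofReal_le_ofReal (le_of_eq ?_)
    by_cases hx : x ∈ E
    · have : Prod.mk x ⁻¹' S = ball 0 r \ T := by
        ext y
        simp [S, T, mem_symmDiff, hx]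
      rw [this, indicator_of_mem hx, measureReal_sdiff inter_subset_left hTm, abs_of_nonneg]
      exact sub_nonneg.2 (measureReal_mono inter_subset_left)
    · have : Prod.mk x ⁻¹' S = T := by
        ext y
        simp [S, T, mem_symmDiff, hx]
      rw [this, indicator_of_notMem hx, zero_sub, abs_neg, abs_of_nonneg measureReal_nonneg]
  calc _ ≤ ∫⁻ x, volume (Prod.mk x ⁻¹' S) := lintegral_mono hpt
    _ = ∫⁻ y, volume ((fun x => (x, y)) ⁻¹' S) := by
      rw [← Measure.prod_apply hS, Measure.prod_apply_symm hS]
    _ ≤ ∫⁻ y, (ball (0 : 𝔼 d) r).indicator (fun _ => ENNReal.ofReal (perimeter d E * r)) y := by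
      refine lintegral_mono fun y => ?_
      by_cases hy : y ∈ ball (0 : 𝔼 d) r
      · rw [indicator_of_mem hy]
        refine ((measure_mono ?_).trans (volume_symmDiff_translate_le hm hE y)).trans
          (ENNReal.ofReal_le_ofReal ?_)
        · exact fun x hx => hx.2
        · have := (mem_ball_zero_iff.1 hy).le
          gcongr
          exact perimeter_nonneg hE
      · have : (fun x => (x, y)) ⁻¹' S = ∅ := by
          ext x
          simp only [S, mem_preimage, mem_inter_iff, hy, false_and, mem_empty_iff_false]
        simp [this]
    _ = _ := by
      rw [lintegral_indicator_const measurableSet_ball, mul_comm]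

/-- A set that is large compared to its perimeter fills at least half of some ball. -/
theorem exists_half_le_volume_inter_ball {E : Set (𝔼 d)} (hm : MeasurableSet E)
    (hE : FinitePerimeter d E) {r : ℝ} (hr : 0 < r)
    (hv : 2 * ENNReal.ofReal (perimeter d E * r) < volume E) :
    ∃ x, volume.real (ball (0 : 𝔼 d) r) / 2 ≤ volume.real (E ∩ ball x r) := by
  by_contra! hlt
  set c := volume.real (ball (0 : 𝔼 d) r) with hc
  have hc' : volume (ball (0 : 𝔼 d) r) = ENNReal.ofReal c :=
    (ofReal_measureReal measure_ball_lt_top.ne).symm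
  have hcpos : 0 < c := ENNReal.toReal_pos (measure_ball_pos _ _ hr).ne' measure_ball_lt_top.ne
  have h1 : ENNReal.ofReal (c / 2) * volume E ≤
      ENNReal.ofReal c * ENNReal.ofReal (perimeter d E * r) := by
    rw [← hc', ← setLIntegral_const]
    refine le_trans ?_ (lintegral_enorm_indicator_sub_le hm hE r)
    rw [← lintegral_indicator hm]
    refine lintegral_mono fun x => ?_
    by_cases hx : x ∈ E
    · simp only [indicator_of_mem hx, Real.enorm_eq_ofReal_abs]
      refine ENNReal.ofReal_le_ofReal (le_trans ?_ (le_abs_self _))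
      linarith [hlt x]
    · simp [indicator_of_notMem hx]
  have h2 : ENNReal.ofReal c = ENNReal.ofReal (c / 2) * 2 := by
    rw [← ENNReal.ofReal_ofNat 2, ← ENNReal.ofReal_mul (by positivity)]
    congr 1
    ring
  rw [h2, mul_assoc, ENNReal.mul_le_mul_iff_right (by simpa using hcpos) ENNReal.ofReal_ne_top]
    at h1
  exact absurd hv h1.not_gt

theorem perSet_translate_subset (E : Set (𝔼 d)) (a : 𝔼 d) :
    perSet d ((fun x => x + a) ⁻¹' E) ⊆ perSet d E := by
  rintro p ⟨F, hF, hc, h1, rfl⟩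
  refine ⟨fun x => F (x - a), hF.comp (contDiff_id.sub contDiff_const),
    hc.comp_homeomorph (Homeomorph.subRight a), fun x => h1 _, ?_⟩
  have hmp := measurePreserving_add_right (volume : Measure (𝔼 d)) a
  have := hmp.setIntegral_preimage_emb (measurableEmbedding_addRight a)
    (fun x => ∑ i, fderiv ℝ F (x - a) (EuclideanSpace.single i (1 : ℝ)) i) E
  simpa [fderiv_comp_sub] using this

theorem perSet_translate (E : Set (𝔼 d)) (a : 𝔼 d) :
    perSet d ((fun x => x + a) ⁻¹' E) = perSet d E := by
  refine (perSet_translate_subset E a).antisymm ?_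
  have := perSet_translate_subset ((fun x => x + a) ⁻¹' E) (-a)
  simpa [preimage_preimage] using this

theorem exists_subseq_tendsto_measureReal_inter {F : ℕ → Set (𝔼 d)}
    (hF : ∀ n, MeasurableSet (F n)) :
    ∃ φ : ℕ → ℕ, StrictMono φ ∧ ∀ A : Set (𝔼 d), MeasurableSet A → volume A ≠ ⊤ →
      ∃ w, Tendsto (fun k => volume.real (F (φ k) ∩ A)) atTop (𝓝 w) := by
  let T : ℕ → StrongDual ℝ (Lp ℝ 1 (volume : Measure (𝔼 d))) := fun n =>
    LinearMap.mkContinuous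
      { toFun := fun f => ∫ x in F n, f x
        map_add' := fun f g => by
          rw [← integral_add (L1.integrable_coeFn f).integrableOn
            (L1.integrable_coeFn g).integrableOn]
          exact integral_congr_ae (ae_restrict_of_ae (Lp.coeFn_add f g))
        map_smul' := fun c f => by
          rw [RingHom.id_apply, ← integral_smul]
          exact integral_congr_ae (ae_restrict_of_ae (Lp.coeFn_smul c f)) } 1 fun f => by
        rw [one_mul, L1.norm_eq_integral_norm]
        exact (norm_integral_le_integral_norm _).trans
          (setIntegral_le_integral (L1.integrable_coeFn f).norm
            (ae_of_all _ fun _ => norm_nonneg _))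
  have : Fact ((1 : ENNReal) ≠ ⊤) := ⟨ENNReal.one_ne_top⟩
  have hT : ∀ n, ‖T n‖ ≤ 1 := fun n => LinearMap.mkContinuous_norm_le _ zero_le_one _
  obtain ⟨f, -, φ, hφ, hlim⟩ := WeakDual.isSeqCompact_closedBall ℝ
    (Lp ℝ 1 (volume : Measure (𝔼 d))) 0 1 (x := fun n => StrongDual.toWeakDual (T n))
    (fun n => by simpa using hT n)
  refine ⟨φ, hφ, fun A hA hfin => ⟨f (indicatorConstLp 1 hA hfin 1), ?_⟩⟩
  refine (((WeakDual.eval_continuous (indicatorConstLp 1 hA hfin (1 : ℝ))).tendsto f).comp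
    hlim).congr fun k => ?_
  change ∫ x in F (φ k), (indicatorConstLp 1 hA hfin (1 : ℝ)) x = _
  rw [setIntegral_indicatorConstLp (hF _)]
  simp [inter_comm]

theorem exists_isFiniteMeasure_le_volume :
    ∃ ν : Measure (𝔼 d), IsFiniteMeasure ν ∧ ν ≤ volume ∧ volume ≪ ν := by
  obtain ⟨g, hpos, hgm, hg⟩ :=
    exists_pos_lintegral_lt_of_sigmaFinite (volume : Measure (𝔼 d)) one_ne_zero
  have hm : Measurable fun x => min (g x : ENNReal) 1 := hgm.coe_nnreal_ennreal.min measurable_const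
  refine ⟨volume.withDensity fun x => min (g x : ENNReal) 1, ?_, ?_, ?_⟩
  · refine isFiniteMeasure_withDensity
      ((lintegral_mono fun x => min_le_left _ _).trans_lt (hg.trans ENNReal.one_lt_top)).ne
  · conv_rhs => rw [← withDensity_one (μ := (volume : Measure (𝔼 d)))]
    exact withDensity_mono (ae_of_all _ fun x => min_le_right _ _)
  · refine withDensity_absolutelyContinuous' hm.aemeasurable (ae_of_all _ fun x => ?_)
    have := hpos x
    simp [this.ne']

theorem measurable_measureReal_inter_ball {E : Set (𝔼 d)} (hm : MeasurableSet E) (r : ℝ) :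
    Measurable fun x => volume.real (E ∩ ball x r) := by
  have hS : MeasurableSet {p : (𝔼 d) × (𝔼 d) | p.2 ∈ E ∧ dist p.2 p.1 < r} :=
    (measurable_snd hm).inter
      (measurableSet_lt (measurable_snd.dist measurable_fst) measurable_const)
  exact (measurable_measure_prodMk_left hS).ennreal_toReal

theorem eventually_measure_symmDiff_le {F : ℕ → Set (𝔼 d)}
    (hF : ∀ n, MeasurableSet (F n)) (hP : ∀ n, FinitePerimeter d (F n)) {M : ℝ}
    (hM : ∀ n, perimeter d (F n) ≤ M)
    (hlim : ∀ A : Set (𝔼 d), MeasurableSet A → volume A ≠ ⊤ →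
      ∃ w, Tendsto (fun k => volume.real (F k ∩ A)) atTop (𝓝 w))
    {ν : Measure (𝔼 d)} [IsFiniteMeasure ν] (hν : ν ≤ volume) {δ : ℝ} (hδ : 0 < δ) :
    ∀ᶠ k in atTop, ∀ l ≥ k, ν (symmDiff (F k) (F l)) ≤ ENNReal.ofReal δ := by
  have hM0 : 0 ≤ M := (perimeter_nonneg (hP 0)).trans (hM 0)
  obtain ⟨r, hr, hMr⟩ : ∃ r : ℝ, 0 < r ∧ M * r ≤ δ / 4 := by
    refine ⟨δ / 4 / (M + 1), by positivity, ?_⟩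
    rw [mul_div_assoc', div_le_iff₀ (by positivity)]
    nlinarith
  set c := volume.real (ball (0 : 𝔼 d) r) with hc
  have hc' : volume (ball (0 : 𝔼 d) r) = ENNReal.ofReal c :=
    (ofReal_measureReal measure_ball_lt_top.ne).symm
  have hcpos : 0 < c := ENNReal.toReal_pos (measure_ball_pos _ _ hr).ne' measure_ball_lt_top.ne
  choose w hw using fun x : 𝔼 d => hlim (ball x r) measurableSet_ball measure_ball_lt_top.ne
  have hvm : ∀ k, Measurable fun x => volume.real (F k ∩ ball x r) :=
    fun k => measurable_measureReal_inter_ball (hF k) r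
  have hwm : Measurable w := measurable_of_tendsto_metrizable hvm (tendsto_pi_nhds.2 hw)
  have hvc : ∀ k x, volume.real (F k ∩ ball x r) ≤ c := by
    intro k x
    have : c = volume.real (ball x r) := by
      rw [hc, measureReal_def, measureReal_def, Measure.addHaar_ball_center volume x]
    rw [this]
    exact measureReal_mono inter_subset_right measure_ball_lt_top.ne
  have hwc : ∀ x, w x ≤ c := fun x => le_of_tendsto' (hw x) fun k => hvc k x
  have hw0 : ∀ x, 0 ≤ w x := fun x => ge_of_tendsto' (hw x) fun k => measureReal_nonneg
  have htend : Tendsto (fun k => ∫⁻ x, ‖volume.real (F k ∩ ball x r) - w x‖ₑ ∂ν) atTop (𝓝 0) := by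
    rw [← lintegral_zero (μ := ν)]
    refine tendsto_lintegral_of_dominated_convergence (fun _ => ENNReal.ofReal c) ?_ ?_ ?_ ?_
    · exact fun k => ((hvm k).sub hwm).enorm
    · refine fun k => ae_of_all _ fun x => ?_
      refine (Real.enorm_eq_ofReal_abs _).trans_le (ENNReal.ofReal_le_ofReal (abs_le.2 ⟨?_, ?_⟩))
      · linarith [hwc x, measureReal_nonneg (μ := volume) (s := F k ∩ ball x r)]
      · linarith [hw0 x, hvc k x]
    · simp [ENNReal.mul_eq_top]
    · refine ae_of_all _ fun x => ?_
      have := ((hw x).sub_const (w x)).enorm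
      simpa using this
  have hev : ∀ᶠ k in atTop, ∫⁻ x, ‖volume.real (F k ∩ ball x r) - w x‖ₑ ∂ν <
      ENNReal.ofReal (c * (δ / 4)) :=
    htend.eventually_lt_const (ENNReal.ofReal_pos.2 (by positivity))
  have hA : ∀ᶠ k in atTop, ∫⁻ x, ‖(F k).indicator (fun _ => c) x - w x‖ₑ ∂ν ≤
      ENNReal.ofReal (c * (δ / 2)) := by
    filter_upwards [hev] with k hk
    calc ∫⁻ x, ‖(F k).indicator (fun _ => c) x - w x‖ₑ ∂ν
        ≤ ∫⁻ x, (‖(F k).indicator (fun _ => c) x - volume.real (F k ∩ ball x r)‖ₑ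
          + ‖volume.real (F k ∩ ball x r) - w x‖ₑ) ∂ν := by
          refine lintegral_mono fun x => ?_
          refine le_trans (le_of_eq ?_) (enorm_add_le _ _)
          rw [sub_add_sub_cancel]
      _ = ∫⁻ x, ‖(F k).indicator (fun _ => c) x - volume.real (F k ∩ ball x r)‖ₑ ∂ν
          + ∫⁻ x, ‖volume.real (F k ∩ ball x r) - w x‖ₑ ∂ν :=
          lintegral_add_right _ ((hvm k).sub hwm).enorm
      _ ≤ ENNReal.ofReal (c * (δ / 4)) + ENNReal.ofReal (c * (δ / 4)) := by
          refine add_le_add ?_ hk.le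
          refine ((lintegral_mono' hν le_rfl).trans
            (lintegral_enorm_indicator_sub_le (hF k) (hP k) r)).trans ?_
          rw [hc', ← ENNReal.ofReal_mul hcpos.le]
          refine ENNReal.ofReal_le_ofReal ?_
          gcongr
          exact (mul_le_mul_of_nonneg_right (hM k) hr.le).trans hMr
      _ = _ := by
          rw [← ENNReal.ofReal_add (by positivity) (by positivity)]
          congr 1
          ring
  obtain ⟨N, hN⟩ := eventually_atTop.1 hA
  filter_upwards [eventually_ge_atTop N] with k hk l hl
  have hmain : ENNReal.ofReal c * ν (symmDiff (F k) (F l)) ≤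
      ENNReal.ofReal c * ENNReal.ofReal δ := by
    calc ENNReal.ofReal c * ν (symmDiff (F k) (F l))
        = ∫⁻ x, (symmDiff (F k) (F l)).indicator (fun _ => ENNReal.ofReal c) x ∂ν :=
          (lintegral_indicator_const ((hF k).symmDiff (hF l)) _).symm
      _ ≤ ∫⁻ x, (‖(F k).indicator (fun _ => c) x - w x‖ₑ
          + ‖(F l).indicator (fun _ => c) x - w x‖ₑ) ∂ν := by
          refine lintegral_mono fun x => ?_
          have h3 : (symmDiff (F k) (F l)).indicator (fun _ => ENNReal.ofReal c) x =
              ‖(F k).indicator (fun _ => c) x - (F l).indicator (fun _ => c) x‖ₑ := by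
            have h4 : ENNReal.ofReal c = ‖c‖ₑ := by
              rw [Real.enorm_eq_ofReal_abs, abs_of_pos hcpos]
            by_cases hx : x ∈ F k <;> by_cases hy : x ∈ F l <;> simp [hx, hy, mem_symmDiff, h4]
          rw [h3]
          refine le_trans (le_of_eq ?_) (enorm_sub_le (E := ℝ))
          rw [sub_sub_sub_cancel_right]
      _ = ∫⁻ x, ‖(F k).indicator (fun _ => c) x - w x‖ₑ ∂ν
          + ∫⁻ x, ‖(F l).indicator (fun _ => c) x - w x‖ₑ ∂ν :=
          lintegral_add_right _ ((measurable_const.indicator (hF l)).sub hwm).enorm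
      _ ≤ ENNReal.ofReal (c * (δ / 2)) + ENNReal.ofReal (c * (δ / 2)) :=
          add_le_add (hN k hk) (hN l (hk.trans hl))
      _ = _ := by
          rw [← ENNReal.ofReal_add (by positivity) (by positivity),
            ← ENNReal.ofReal_mul hcpos.le]
          congr 1
          ring
  rwa [ENNReal.mul_le_mul_iff_right (by simpa using hcpos) ENNReal.ofReal_ne_top] at hmain

/-- Sets of uniformly bounded perimeter are precompact for almost everywhere convergence. -/
theorem exists_subseq_ae_eventually_mem_iff {F : ℕ → Set (𝔼 d)}
    (hF : ∀ n, MeasurableSet (F n)) (hP : ∀ n, FinitePerimeter d (F n)) {M : ℝ}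
    (hM : ∀ n, perimeter d (F n) ≤ M) :
    ∃ φ : ℕ → ℕ, StrictMono φ ∧ ∃ E : Set (𝔼 d), MeasurableSet E ∧
      ∀ᵐ x, ∀ᶠ k in atTop, (x ∈ F (φ k) ↔ x ∈ E) := by
  obtain ⟨φ, hφ, hlim⟩ := exists_subseq_tendsto_measureReal_inter hF
  obtain ⟨ν, hfin, hν, hac⟩ := exists_isFiniteMeasure_le_volume (d := d)
  obtain ⟨ψ, hψ, hψ'⟩ := extraction_forall_of_eventually fun n : ℕ =>
    eventually_measure_symmDiff_le (fun k => hF (φ k)) (fun k => hP (φ k)) (fun k => hM (φ k))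
      hlim hν (δ := (1 / 2) ^ n) (by positivity)
  let H : ℕ → Set (𝔼 d) := fun k => F (φ (ψ k))
  have hsum : ∑' n, ν (symmDiff (H n) (H (n + 1))) ≠ ⊤ := by
    refine ne_top_of_le_ne_top summable_geometric_two.tsum_ofReal_ne_top
      (ENNReal.tsum_le_tsum fun n => hψ' n _ (hψ.monotone n.le_succ))
  refine ⟨φ ∘ ψ, hφ.comp hψ, ⋃ N, ⋂ k ≥ N, H k, ?_, ?_⟩
  · exact MeasurableSet.iUnion fun N => MeasurableSet.iInter fun k =>
      MeasurableSet.iInter fun _ => hF _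
  · filter_upwards [hac.ae_le (ae_eventually_notMem hsum)] with x hx
    obtain ⟨N, hN⟩ := eventually_atTop.1 hx
    have hstep : ∀ k ≥ N, (x ∈ H k ↔ x ∈ H N) := by
      intro k hk
      induction k, hk using Nat.le_induction with
      | base => rfl
      | succ k hk ih =>
        rw [← ih]
        have := hN k hk
        rw [mem_symmDiff] at this
        tauto
    filter_upwards [eventually_ge_atTop N] with k hk
    change x ∈ H k ↔ _
    simp only [mem_iUnion, mem_iInter]
    constructor
    · exact fun h => ⟨N, fun j hj => (hstep j hj).2 ((hstep k hk).1 h)⟩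
    · rintro ⟨N', h⟩
      exact (hstep k hk).2 ((hstep _ (le_max_left N N')).1 (h _ (le_max_right N N')))

theorem tendsto_measure_inter_of_ae_eventually_mem_iff {F : ℕ → Set (𝔼 d)} {E A : Set (𝔼 d)}
    (hF : ∀ n, MeasurableSet (F n)) (hE : MeasurableSet E) (hA : MeasurableSet A)
    (hfin : volume A ≠ ⊤) (h : ∀ᵐ x, ∀ᶠ k in atTop, (x ∈ F k ↔ x ∈ E)) :
    Tendsto (fun k => volume (F k ∩ A)) atTop (𝓝 (volume (E ∩ A))) := by
  refine tendsto_measure_of_ae_tendsto_indicator atTop (hE.inter hA) (fun k => (hF k).inter hA)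
    hA hfin (Eventually.of_forall fun k => inter_subset_right) ?_
  filter_upwards [h] with x hx
  filter_upwards [hx] with k hk
  simp [hk]

theorem volume_le_liminf_of_ae_eventually_mem_iff {F : ℕ → Set (𝔼 d)} {E : Set (𝔼 d)}
    (hF : ∀ n, MeasurableSet (F n)) (hE : MeasurableSet E)
    (h : ∀ᵐ x, ∀ᶠ k in atTop, (x ∈ F k ↔ x ∈ E)) :
    volume E ≤ liminf (fun k => volume (F k)) atTop := by
  have hU : E = ⋃ R : ℕ, E ∩ ball 0 (R : ℝ) := by
    rw [← inter_iUnion, iUnion_ball_nat, inter_univ]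
  rw [hU]
  refine le_of_tendsto' (tendsto_measure_iUnion_atTop ?_) fun R => ?_
  · exact fun i j hij => inter_subset_inter_right _ (ball_subset_ball (by exact_mod_cast hij))
  · rw [Function.comp_apply, ← (tendsto_measure_inter_of_ae_eventually_mem_iff hF hE
      measurableSet_ball measure_ball_lt_top.ne h).liminf_eq]
    exact liminf_le_liminf (Eventually.of_forall fun k => measure_mono inter_subset_left)

/-- Lower semicontinuity of the perimeter. -/
theorem perimeter_le_liminf_of_ae_eventually_mem_iff {F : ℕ → Set (𝔼 d)} {E : Set (𝔼 d)}
    (hF : ∀ n, MeasurableSet (F n)) (hE : MeasurableSet E)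
    (hP : ∀ n, FinitePerimeter d (F n)) {M : ℝ} (hM : ∀ n, perimeter d (F n) ≤ M)
    (h : ∀ᵐ x, ∀ᶠ k in atTop, (x ∈ F k ↔ x ∈ E)) :
    perimeter d E ≤ liminf (fun k => perimeter d (F k)) atTop := by
  refine csSup_le ⟨0, zero_mem_perSet E⟩ ?_
  rintro p ⟨X, hX, hc, h1, rfl⟩
  set D : (𝔼 d) → ℝ := fun x => ∑ i, fderiv ℝ X x (EuclideanSpace.single i (1 : ℝ)) i with hD
  have hDc : Continuous D := by
    have := hX.continuous_fderiv (by simp)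
    fun_prop
  have hDs : HasCompactSupport D :=
    (hc.fderiv ℝ).comp_left (g := fun L : (𝔼 d) →L[ℝ] 𝔼 d =>
      ∑ i, L (EuclideanSpace.single i (1 : ℝ)) i) (by simp)
  have hDi : Integrable D := hDc.integrable_of_hasCompactSupport hDs
  have hlim : Tendsto (fun k => ∫ x in F k, D x) atTop (𝓝 (∫ x in E, D x)) := by
    simp_rw [← integral_indicator (hF _), ← integral_indicator hE]
    refine tendsto_integral_of_dominated_convergence (fun x => ‖D x‖) ?_ hDi.norm ?_ ?_
    · exact fun k => (hDi.indicator (hF k)).aestronglyMeasurable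
    · exact fun k => ae_of_all _ fun x => norm_indicator_le_norm_self _ _
    · filter_upwards [h] with x hx
      refine tendsto_const_nhds.congr' ?_
      filter_upwards [hx] with k hk
      by_cases hxE : x ∈ E
      · rw [indicator_of_mem hxE, indicator_of_mem (hk.2 hxE)]
      · rw [indicator_of_notMem hxE, indicator_of_notMem fun h' => hxE (hk.1 h')]
  rw [← hlim.liminf_eq]
  refine liminf_le_liminf (Eventually.of_forall fun k => le_csSup (hP k) ⟨X, hX, hc, h1, rfl⟩)
    hlim.isBoundedUnder_ge ?_
  exact (isBoundedUnder_of ⟨M, hM⟩ : IsBoundedUnder (· ≤ ·) atTop _).isCoboundedUnder_ge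

end

/-- compactness up to translations for sets of uniformly bounded perimeter. -/
theorem compactness_up_to_translations (d : ℕ) (E : ℕ → Set (EuclideanSpace ℝ (Fin d)))
    (hmeas : ∀ n, MeasurableSet (E n)) (hfp : ∀ n, FinitePerimeter d (E n))
    (M : ℝ) (hM : ∀ n, perimeter d (E n) ≤ M) :
    Tendsto (fun n => volume (E n)) atTop (𝓝 0) ∨
      ∃ (E' : Set (EuclideanSpace ℝ (Fin d))) (a : ℕ → EuclideanSpace ℝ (Fin d))
        (nk : ℕ → ℕ), StrictMono nk ∧ MeasurableSet E' ∧ 0 < volume E' ∧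
        (∀ K : Set (EuclideanSpace ℝ (Fin d)), IsCompact K →
          Tendsto (fun k =>
            volume (symmDiff ((fun x => x + a k) ⁻¹' E (nk k)) E' ∩ K)) atTop (𝓝 0)) ∧
        volume E' ≤ liminf (fun k => volume (E (nk k))) atTop ∧
        perimeter d E' ≤ liminf (fun k => perimeter d (E (nk k))) atTop := by
  refine or_iff_not_imp_left.2 fun hnot => ?_
  have hM0 : 0 ≤ M := (perimeter_nonneg (hfp 0)).trans (hM 0)
  rw [ENNReal.tendsto_atTop_zero] at hnot
  push Not at hnot
  obtain ⟨ε, hε, hfreq⟩ := hnot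
  obtain ⟨m, hm, hmε⟩ := extraction_of_frequently_atTop (frequently_atTop.2 hfreq)
  obtain ⟨q, hq0, hqε⟩ := ENNReal.lt_iff_exists_nnreal_btwn.1 hε
  have hq : (0 : ℝ) < q := by exact_mod_cast hq0
  obtain ⟨r, hr, hMr⟩ : ∃ r : ℝ, 0 < r ∧ M * r ≤ q / 2 := by
    refine ⟨q / 2 / (M + 1), by positivity, ?_⟩
    rw [mul_div_assoc', div_le_iff₀ (by positivity)]
    nlinarith
  have hlarge : ∀ n, ∃ x, volume.real (ball (0 : EuclideanSpace ℝ (Fin d)) r) / 2 ≤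
      volume.real (E (m n) ∩ ball x r) := by
    intro n
    refine exists_half_le_volume_inter_ball (hmeas _) (hfp _) hr (lt_of_le_of_lt ?_ (hmε n))
    calc 2 * ENNReal.ofReal (perimeter d (E (m n)) * r)
        ≤ 2 * ENNReal.ofReal (q / 2) := by
          gcongr
          exact (mul_le_mul_of_nonneg_right (hM _) hr.le).trans hMr
      _ = q := by
          rw [← ENNReal.ofReal_ofNat 2, ← ENNReal.ofReal_mul (by positivity),
            mul_div_cancel₀ _ two_ne_zero, ENNReal.ofReal_coe_nnreal]
      _ ≤ ε := hqε.le
  choose a ha using hlarge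
  let F : ℕ → Set (EuclideanSpace ℝ (Fin d)) := fun n => (fun x => x + a n) ⁻¹' E (m n)
  have hper : ∀ n, perimeter d (F n) = perimeter d (E (m n)) := fun n =>
    congrArg sSup (perSet_translate _ _)
  have hvol : ∀ n, volume (F n) = volume (E (m n)) := fun n => measure_preimage_add_right _ _ _
  have hFm : ∀ n, MeasurableSet (F n) := fun n => measurable_add_const _ (hmeas _)
  have hFP : ∀ n, FinitePerimeter d (F n) := fun n => by
    simpa only [FinitePerimeter, F, perSet_translate] using hfp (m n)
  have hFM : ∀ n, perimeter d (F n) ≤ M := fun n => (hper n).trans_le (hM _)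
  obtain ⟨φ, hφ, E', hE', hae⟩ := exists_subseq_ae_eventually_mem_iff hFm hFP hFM
  refine ⟨E', a ∘ φ, m ∘ φ, hm.comp hφ, hE', ?_, fun K hK => ?_, ?_, ?_⟩
  · have hlim := tendsto_measure_inter_of_ae_eventually_mem_iff (fun k => hFm (φ k)) hE'
      (measurableSet_ball (x := 0) (ε := r)) measure_ball_lt_top.ne hae
    have hlow : ∀ k, ENNReal.ofReal (volume.real (ball (0 : EuclideanSpace ℝ (Fin d)) r) / 2) ≤
        volume (F (φ k) ∩ ball 0 r) := by
      intro k
      have h1 : F (φ k) ∩ ball 0 r =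
          (fun x => x + a (φ k)) ⁻¹' (E (m (φ k)) ∩ ball (a (φ k)) r) := by
        rw [preimage_inter, preimage_add_right_ball, sub_self]
      rw [h1, measure_preimage_add_right]
      exact ENNReal.ofReal_le_of_le_toReal (ha (φ k))
    refine (ENNReal.ofReal_pos.2 ?_).trans_le
      ((ge_of_tendsto' hlim hlow).trans (measure_mono inter_subset_left))
    exact half_pos (ENNReal.toReal_pos (measure_ball_pos _ _ hr).ne' measure_ball_lt_top.ne)
  · have := tendsto_measure_inter_of_ae_eventually_mem_iff (E := ∅)
      (fun k => (hFm (φ k)).symmDiff hE') MeasurableSet.empty hK.measurableSet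
      hK.measure_lt_top.ne (by
        filter_upwards [hae] with x hx
        filter_upwards [hx] with k hk
        simp [mem_symmDiff, hk])
    simpa [F] using this
  · simpa only [hvol, Function.comp_apply] using
      volume_le_liminf_of_ae_eventually_mem_iff (fun k => hFm (φ k)) hE' hae
  · simpa only [hper, Function.comp_apply] using
      perimeter_le_liminf_of_ae_eventually_mem_iff (fun k => hFm (φ k)) hE'
        (fun k => hFP (φ k)) (fun k => hFM (φ k)) hae
end
end
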